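/- Let Ra ∈ ℝ, Pr > 0, and let F : [0,1] → ℝ be continuous with ∫₀¹ F(z) dz = 0. Let q, S, ψ : [0,∞) × ℝ² → ℝ be smooth in all variables such that for all t ≥ 0: q(t,·) = −Δψ(t,·) on D; ψ(t,·) = 0 and q(t,·) = 0 on ∂D; ∂ₓS(t,0,z) = F(z), ∂ₓS(t,1,z) = 0, ∂_zS(t,x,0) = ∂_zS(t,x,1) = 0; ∂_tq + J(q(t,·),ψ(t,·)) = Δq(t,·) − Ra·∂ₓS(t,·) on D; ∂_tS + J(S(t,·),ψ(t,·)) = (1/Pr)ΔS(t,·) on D; and ∫_D S(0,x,z) d(x,z) = 0. Then there exists a constant C ≥ 0, depending only on Ra and Pr, such that limsup_{t→∞} ∫_D [q(t,x,z)² + S(t,x,z)²] d(x,z) ≤ C · ∫₀¹ F(z)² dz. -/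

import Mathlib

open MeasureTheory

/-- The closed unit square `[0,1] × [0,1]` in `ℝ²`. -/
def unitSq : Set (ℝ × ℝ) := (Set.Icc (0:ℝ) 1) ×ˢ (Set.Icc (0:ℝ) 1)

/-- Partial derivative in the first (`x`) direction. -/
noncomputable def pdx (f : ℝ × ℝ → ℝ) (p : ℝ × ℝ) : ℝ := fderiv ℝ f p (1, 0)

/-- Partial derivative in the second (`z`) direction. -/
noncomputable def pdz (f : ℝ × ℝ → ℝ) (p : ℝ × ℝ) : ℝ := fderiv ℝ f p (0, 1)

/-- The Jacobian operator `J(g,h) = ∂ₓg ∂_z h − ∂_z g ∂ₓ h`. -/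
noncomputable def Jac (g h : ℝ × ℝ → ℝ) (p : ℝ × ℝ) : ℝ :=
  pdx g p * pdz h p - pdz g p * pdx h p

/-- The Laplacian `Δ = ∂ₓₓ + ∂_zz`. -/
noncomputable def lap (f : ℝ × ℝ → ℝ) (p : ℝ × ℝ) : ℝ := pdx (pdx f) p + pdz (pdz f) p

/-- `f : ℝ → ℝ × ℝ → ℝ` is jointly smooth in time and space. -/
def JointlySmooth (f : ℝ → ℝ × ℝ → ℝ) : Prop :=
  ContDiff ℝ (⊤ : ℕ∞) (fun q : ℝ × (ℝ × ℝ) => f q.1 q.2)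

open scoped ContDiff

lemma unitSq_eq_Icc : unitSq = Set.Icc ((0, 0) : ℝ × ℝ) (1, 1) := by
  rw [unitSq, Set.Icc_prod_eq]

lemma isCompact_unitSq : IsCompact unitSq := isCompact_Icc.prod isCompact_Icc

lemma measurableSet_unitSq : MeasurableSet unitSq := isCompact_unitSq.measurableSet

lemma Continuous.integrableOn_unitSq {f : ℝ × ℝ → ℝ} (hf : Continuous f) :
    IntegrableOn f unitSq :=
  hf.continuousOn.integrableOn_compact isCompact_unitSq

lemma mk_mem_frontier_unitSq {x z : ℝ} (hx : x ∈ Set.Icc (0 : ℝ) 1) (hz : z ∈ Set.Icc (0 : ℝ) 1)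
    (h : x = 0 ∨ x = 1 ∨ z = 0 ∨ z = 1) : (x, z) ∈ frontier unitSq := by
  rw [isCompact_unitSq.isClosed.frontier_eq, unitSq, interior_prod_eq, interior_Icc]
  refine ⟨⟨hx, hz⟩, fun hmem => ?_⟩
  obtain ⟨⟨h1, h2⟩, h3, h4⟩ := hmem
  simp only at h1 h2 h3 h4
  rcases h with rfl | rfl | rfl | rfl <;> linarith

/-- Fubini on the unit square, with the `z`-integral inside. -/
lemma setIntegral_unitSq' {f : ℝ × ℝ → ℝ} (hf : Continuous f) :
    ∫ p in unitSq, f p = ∫ x in (0 : ℝ)..1, ∫ z in (0 : ℝ)..1, f (x, z) := by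
  simp only [intervalIntegral.integral_of_le (zero_le_one' ℝ), ← integral_Icc_eq_integral_Ioc]
  rw [Measure.volume_eq_prod]
  exact setIntegral_prod f hf.integrableOn_unitSq

/-- Fubini on the unit square, with the `x`-integral inside. -/
lemma setIntegral_unitSq {f : ℝ × ℝ → ℝ} (hf : Continuous f) :
    ∫ p in unitSq, f p = ∫ z in (0 : ℝ)..1, ∫ x in (0 : ℝ)..1, f (x, z) := by
  rw [setIntegral_unitSq' hf]
  refine intervalIntegral_intervalIntegral_swap (F := fun x z => f (x, z)) ?_
  refine IntegrableOn.mono_set (t := unitSq) hf.integrableOn_unitSq ?_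
  rw [Set.uIoc_of_le zero_le_one]
  exact Set.prod_mono Set.Ioc_subset_Icc_self Set.Ioc_subset_Icc_self

section PartialDerivatives

variable {f g : ℝ × ℝ → ℝ}

lemma ContDiff.pdx (hf : ContDiff ℝ ∞ f) : ContDiff ℝ ∞ (pdx f) :=
  (hf.fderiv_right (m := ∞) (by simp)).clm_apply contDiff_const

lemma ContDiff.pdz (hf : ContDiff ℝ ∞ f) : ContDiff ℝ ∞ (pdz f) :=
  (hf.fderiv_right (m := ∞) (by simp)).clm_apply contDiff_const

lemma ContDiff.differentiable_of_smooth (hf : ContDiff ℝ ∞ f) : Differentiable ℝ f :=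
  hf.differentiable (by simp)

lemma pdx_mul (hf : ContDiff ℝ ∞ f) (hg : ContDiff ℝ ∞ g) (p : ℝ × ℝ) :
    pdx (fun p => f p * g p) p = f p * pdx g p + pdx f p * g p := by
  simp only [pdx]
  rw [fderiv_fun_mul (hf.differentiable_of_smooth p) (hg.differentiable_of_smooth p)]
  simp [mul_comm]

lemma pdz_mul (hf : ContDiff ℝ ∞ f) (hg : ContDiff ℝ ∞ g) (p : ℝ × ℝ) :
    pdz (fun p => f p * g p) p = f p * pdz g p + pdz f p * g p := by
  simp only [pdz]
  rw [fderiv_fun_mul (hf.differentiable_of_smooth p) (hg.differentiable_of_smooth p)]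
  simp [mul_comm]

lemma pdx_neg (p : ℝ × ℝ) : pdx (fun p => -f p) p = -pdx f p := by
  simp [pdx, fderiv_fun_neg]

lemma pdx_pdz_comm (hf : ContDiff ℝ ∞ f) (p : ℝ × ℝ) : pdx (pdz f) p = pdz (pdx f) p := by
  have hd : DifferentiableAt ℝ (fderiv ℝ f) p :=
    ((hf.fderiv_right (m := ∞) (by simp)).differentiable (by simp)) p
  have hsymm : IsSymmSndFDerivAt ℝ f p :=
    (contDiff_infty.1 hf 2).contDiffAt.isSymmSndFDerivAt (by simp)
  have key : ∀ v w : ℝ × ℝ,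
      fderiv ℝ (fun y => fderiv ℝ f y v) p w = fderiv ℝ (fderiv ℝ f) p w v := by
    intro v w
    rw [fderiv_clm_apply hd (differentiableAt_const v)]
    simp
  change fderiv ℝ (fun y => fderiv ℝ f y (0, 1)) p (1, 0) =
    fderiv ℝ (fun y => fderiv ℝ f y (1, 0)) p (0, 1)
  rw [key, key, hsymm]

lemma hasDerivAt_pdx (hf : ContDiff ℝ ∞ f) (x z : ℝ) :
    HasDerivAt (fun s => f (s, z)) (pdx f (x, z)) x := by
  have h := (hf.differentiable_of_smooth (x, z)).hasFDerivAt
  exact h.comp_hasDerivAt x ((hasDerivAt_id x).prodMk (hasDerivAt_const x z))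

lemma hasDerivAt_pdz (hf : ContDiff ℝ ∞ f) (x z : ℝ) :
    HasDerivAt (fun s => f (x, s)) (pdz f (x, z)) z := by
  have h := (hf.differentiable_of_smooth (x, z)).hasFDerivAt
  exact h.comp_hasDerivAt z ((hasDerivAt_const z x).prodMk (hasDerivAt_id z))

/-- The divergence theorem on the unit square. -/
lemma integral_div_unitSq (hf : ContDiff ℝ ∞ f) (hg : ContDiff ℝ ∞ g) :
    ∫ p in unitSq, (pdx f p + pdz g p) =
      (((∫ x in (0 : ℝ)..1, g (x, 1)) - ∫ x in (0 : ℝ)..1, g (x, 0)) +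
        ∫ z in (0 : ℝ)..1, f (1, z)) - ∫ z in (0 : ℝ)..1, f (0, z) := by
  have hint := (hf.pdx.continuous.add hg.pdz.continuous).integrableOn_unitSq
  rw [unitSq_eq_Icc] at hint ⊢
  exact integral_divergence_prod_Icc_of_hasFDerivAt_of_le f g (fderiv ℝ f) (fderiv ℝ g)
    (0, 0) (1, 1) (by simp [Prod.le_def]) hf.continuous.continuousOn hg.continuous.continuousOn
    (fun p _ => (hf.differentiable_of_smooth p).hasFDerivAt)
    (fun p _ => (hg.differentiable_of_smooth p).hasFDerivAt) hint

lemma intervalIntegral_eq_zero_of_forall {h : ℝ → ℝ} (hs : ∀ s ∈ Set.Icc (0 : ℝ) 1, h s = 0) :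
    ∫ s in (0 : ℝ)..1, h s = 0 := by
  rw [intervalIntegral.integral_congr (g := fun _ => (0 : ℝ))]
  · simp
  · intro s hmem
    rw [Set.uIcc_of_le zero_le_one] at hmem
    exact hs s hmem

/-- The Jacobian against a stream function vanishing on the boundary has zero mean. -/
lemma integral_Jac_eq_zero (hf : ContDiff ℝ ∞ f) (hg : ContDiff ℝ ∞ g)
    (hg0 : ∀ p ∈ frontier unitSq, g p = 0) : ∫ p in unitSq, Jac f g p = 0 := by
  have hdiv := integral_div_unitSq (hg.neg.mul hf.pdz) (hg.mul hf.pdx)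
  have hJ : ∀ p, pdx (fun p => -g p * pdz f p) p + pdz (fun p => g p * pdx f p) p = Jac f g p := by
    intro p
    rw [pdx_mul hg.neg hf.pdz, pdz_mul hg hf.pdx, pdx_neg, pdx_pdz_comm hf, Jac]
    ring
  simp only [hJ] at hdiv
  have h0 : (0 : ℝ) ∈ Set.Icc (0 : ℝ) 1 := by simp
  have h1 : (1 : ℝ) ∈ Set.Icc (0 : ℝ) 1 := by simp
  rw [hdiv, intervalIntegral_eq_zero_of_forall fun s hs => ?_,
    intervalIntegral_eq_zero_of_forall fun s hs => ?_,
    intervalIntegral_eq_zero_of_forall fun s hs => ?_,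
    intervalIntegral_eq_zero_of_forall fun s hs => ?_]
  · simp
  · simp [hg0 _ (mk_mem_frontier_unitSq h0 hs (by simp))]
  · simp [hg0 _ (mk_mem_frontier_unitSq h1 hs (by simp))]
  · simp [hg0 _ (mk_mem_frontier_unitSq hs h0 (by simp))]
  · simp [hg0 _ (mk_mem_frontier_unitSq hs h1 (by simp))]

/-- The transport term drops out of the `L²` balance. -/
lemma integral_mul_Jac_eq_zero (hf : ContDiff ℝ ∞ f) (hg : ContDiff ℝ ∞ g)
    (hg0 : ∀ p ∈ frontier unitSq, g p = 0) : ∫ p in unitSq, f p * Jac f g p = 0 := by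
  have h := integral_Jac_eq_zero (hf.mul hf) hg hg0
  have hJ : ∀ p, Jac (fun p => f p * f p) g p = 2 * (f p * Jac f g p) := by
    intro p
    simp only [Jac, pdx_mul hf hf, pdz_mul hf hf]
    ring
  simp only [hJ, integral_const_mul] at h
  linarith

lemma ContDiff.lap (hf : ContDiff ℝ ∞ f) : ContDiff ℝ ∞ (lap f) :=
  hf.pdx.pdx.add hf.pdz.pdz

lemma ContDiff.jac (hf : ContDiff ℝ ∞ f) (hg : ContDiff ℝ ∞ g) : ContDiff ℝ ∞ (Jac f g) :=
  (hf.pdx.mul hg.pdz).sub (hf.pdz.mul hg.pdx)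

/-- Green's first identity on the unit square. -/
lemma integral_mul_lap (hf : ContDiff ℝ ∞ f) :
    ∫ p in unitSq, f p * lap f p =
      ((((∫ x in (0 : ℝ)..1, f (x, 1) * pdz f (x, 1)) -
        ∫ x in (0 : ℝ)..1, f (x, 0) * pdz f (x, 0)) +
        ∫ z in (0 : ℝ)..1, f (1, z) * pdx f (1, z)) -
        ∫ z in (0 : ℝ)..1, f (0, z) * pdx f (0, z)) -
        ((∫ p in unitSq, pdx f p ^ 2) + ∫ p in unitSq, pdz f p ^ 2) := by
  rw [← integral_div_unitSq (hf.mul hf.pdx) (hf.mul hf.pdz)]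
  have hx := (hf.pdx.continuous.fun_pow 2).integrableOn_unitSq
  have hz := (hf.pdz.continuous.fun_pow 2).integrableOn_unitSq
  have hd :=
    ((hf.mul hf.pdx).pdx.continuous.fun_add (hf.mul hf.pdz).pdz.continuous).integrableOn_unitSq
  rw [← integral_add hx hz, ← integral_sub hd (hx.fun_add hz)]
  congr 1
  funext p
  rw [pdx_mul hf hf.pdx, pdz_mul hf hf.pdz, lap]
  ring

end PartialDerivatives

section Poincare

/-- Jensen's inequality for the square on the unit interval. -/
lemma sq_intervalIntegral_le {f : ℝ → ℝ} (hf : Continuous f) :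
    (∫ s in (0 : ℝ)..1, f s) ^ 2 ≤ ∫ s in (0 : ℝ)..1, f s ^ 2 := by
  set m := ∫ s in (0 : ℝ)..1, f s with hm
  have h : 0 ≤ ∫ s in (0 : ℝ)..1, (f s - m) ^ 2 :=
    intervalIntegral.integral_nonneg zero_le_one fun s _ => sq_nonneg _
  have hexp : ∫ s in (0 : ℝ)..1, (f s - m) ^ 2 = (∫ s in (0 : ℝ)..1, f s ^ 2) - m ^ 2 := by
    have hfun : (fun s => (f s - m) ^ 2) = fun s => f s ^ 2 - (2 * m * f s - m ^ 2) := by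
      funext s; ring
    rw [hfun, intervalIntegral.integral_sub ((hf.fun_pow 2).intervalIntegrable _ _)
      (((hf.const_mul (2 * m)).fun_sub continuous_const).intervalIntegrable _ _),
      intervalIntegral.integral_sub ((hf.const_mul (2 * m)).intervalIntegrable _ _)
      (continuous_const.intervalIntegrable _ _), intervalIntegral.integral_const_mul, ← hm]
    simp
    ring
  linarith

lemma sq_sub_le_integral_sq_deriv {f f' : ℝ → ℝ} (hf : ∀ s, HasDerivAt f (f' s) s)
    (hf' : Continuous f') {a b : ℝ} (ha : a ∈ Set.Icc (0 : ℝ) 1) (hb : b ∈ Set.Icc (0 : ℝ) 1) :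
    (f b - f a) ^ 2 ≤ ∫ s in (0 : ℝ)..1, f' s ^ 2 := by
  have hftc : ∫ s in a..b, f' s = f b - f a :=
    intervalIntegral.integral_eq_sub_of_hasDerivAt (fun s _ => hf s) (hf'.intervalIntegrable _ _)
  have habs : |f b - f a| ≤ ∫ s in (0 : ℝ)..1, |f' s| := by
    rw [← hftc, ← Real.norm_eq_abs]
    refine intervalIntegral.norm_integral_le_integral_norm_uIoc.trans ?_
    rw [intervalIntegral.integral_of_le zero_le_one]
    refine setIntegral_mono_set (hf'.abs.integrableOn_Ioc) (ae_of_all _ fun s => abs_nonneg _) ?_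
    refine LE.le.eventuallyLE ?_
    exact Set.Ioc_subset_Ioc (le_min ha.1 hb.1) (max_le ha.2 hb.2)
  calc (f b - f a) ^ 2 = |f b - f a| ^ 2 := (sq_abs _).symm
    _ ≤ (∫ s in (0 : ℝ)..1, |f' s|) ^ 2 := pow_le_pow_left₀ (abs_nonneg _) habs 2
    _ ≤ ∫ s in (0 : ℝ)..1, |f' s| ^ 2 := sq_intervalIntegral_le hf'.abs
    _ = ∫ s in (0 : ℝ)..1, f' s ^ 2 := by simp only [sq_abs]

lemma sq_sub_integral_le_integral_sq_deriv {f f' : ℝ → ℝ} (hf : ∀ s, HasDerivAt f (f' s) s)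
    (hf' : Continuous f') {a : ℝ} (ha : a ∈ Set.Icc (0 : ℝ) 1) :
    (f a - ∫ s in (0 : ℝ)..1, f s) ^ 2 ≤ ∫ s in (0 : ℝ)..1, f' s ^ 2 := by
  have hc : Continuous f := continuous_iff_continuousAt.2 fun s => (hf s).continuousAt
  have heq : f a - ∫ s in (0 : ℝ)..1, f s = ∫ s in (0 : ℝ)..1, (f a - f s) := by
    rw [intervalIntegral.integral_sub (continuous_const.intervalIntegrable _ _)
      (hc.intervalIntegrable _ _)]
    simp
  rw [heq]
  refine (sq_intervalIntegral_le (continuous_const.sub hc)).trans ?_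
  calc ∫ s in (0 : ℝ)..1, (f a - f s) ^ 2
      ≤ ∫ _ in (0 : ℝ)..1, ∫ s in (0 : ℝ)..1, f' s ^ 2 :=
        intervalIntegral.integral_mono_on zero_le_one
          (((continuous_const.sub hc).pow 2).intervalIntegrable _ _)
          (continuous_const.intervalIntegrable _ _)
          fun s hs => sq_sub_le_integral_sq_deriv hf hf' hs ha
    _ = ∫ s in (0 : ℝ)..1, f' s ^ 2 := by simp

variable {u : ℝ × ℝ → ℝ}

lemma continuous_intervalIntegral_fst (hu : Continuous u) :
    Continuous fun z => ∫ x in (0 : ℝ)..1, u (x, z) :=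
  intervalIntegral.continuous_parametric_intervalIntegral_of_continuous'
    (f := fun z x => u (x, z)) (by fun_prop) 0 1

lemma continuous_intervalIntegral_snd (hu : Continuous u) :
    Continuous fun x => ∫ z in (0 : ℝ)..1, u (x, z) :=
  intervalIntegral.continuous_parametric_intervalIntegral_of_continuous'
    (f := fun x z => u (x, z)) (by fun_prop) 0 1

/-- Pointwise Poincaré-type bound for functions of zero mean on the unit square. -/
lemma sq_le_of_integral_eq_zero (hu : ContDiff ℝ ∞ u) (hmean : ∫ p in unitSq, u p = 0)
    {x z : ℝ} (hx : x ∈ Set.Icc (0 : ℝ) 1) (hz : z ∈ Set.Icc (0 : ℝ) 1) :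
    u (x, z) ^ 2 ≤ 2 * (∫ s in (0 : ℝ)..1, pdx u (s, z) ^ 2) + 2 * ∫ p in unitSq, pdz u p ^ 2 := by
  have huc := hu.continuous
  have hsnd := continuous_intervalIntegral_snd huc
  have hfluct := sq_sub_integral_le_integral_sq_deriv (fun s => hasDerivAt_pdx hu s z)
    (hu.pdx.continuous.comp (by fun_prop : Continuous fun s : ℝ => (s, z))) hx
  have hslice : (∫ s in (0 : ℝ)..1, u (s, z)) ^ 2 ≤ ∫ p in unitSq, pdz u p ^ 2 := by
    have heq : ∫ s in (0 : ℝ)..1, u (s, z) =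
        ∫ s in (0 : ℝ)..1, (u (s, z) - ∫ r in (0 : ℝ)..1, u (s, r)) := by
      rw [intervalIntegral.integral_sub
        (Continuous.intervalIntegrable (by fun_prop) _ _)
        (hsnd.intervalIntegrable _ _), ← setIntegral_unitSq' huc, hmean, sub_zero]
    have hc : Continuous fun s => u (s, z) - ∫ r in (0 : ℝ)..1, u (s, r) := by fun_prop
    have hsq := hu.pdz.continuous.fun_pow 2
    rw [heq, setIntegral_unitSq' hsq]
    refine (sq_intervalIntegral_le hc).trans ?_
    exact intervalIntegral.integral_mono_on zero_le_one ((hc.pow 2).intervalIntegrable _ _)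
      ((continuous_intervalIntegral_snd hsq).intervalIntegrable _ _)
      fun s _ => sq_sub_integral_le_integral_sq_deriv (fun r => hasDerivAt_pdz hu s r)
        (hu.pdz.continuous.comp (by fun_prop : Continuous fun r : ℝ => (s, r))) hz
  nlinarith [sq_nonneg (u (x, z) - 2 * ∫ s in (0 : ℝ)..1, u (s, z))]

lemma integral_two_mul_add_const (hu : ContDiff ℝ ∞ u) (b : ℝ) :
    ∫ z in (0 : ℝ)..1, (2 * (∫ s in (0 : ℝ)..1, pdx u (s, z) ^ 2) + 2 * b) =
      2 * (∫ p in unitSq, pdx u p ^ 2) + 2 * b := by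
  have hsq := hu.pdx.continuous.fun_pow 2
  have hc := continuous_intervalIntegral_fst hsq
  rw [intervalIntegral.integral_add ((hc.const_mul 2).intervalIntegrable _ _)
    (continuous_const.intervalIntegrable _ _), intervalIntegral.integral_const_mul,
    setIntegral_unitSq hsq]
  simp

/-- Trace inequality for functions of zero mean on the unit square. -/
lemma integral_trace_sq_le (hu : ContDiff ℝ ∞ u) (hmean : ∫ p in unitSq, u p = 0)
    {x : ℝ} (hx : x ∈ Set.Icc (0 : ℝ) 1) :
    ∫ z in (0 : ℝ)..1, u (x, z) ^ 2 ≤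
      2 * (∫ p in unitSq, pdx u p ^ 2) + 2 * ∫ p in unitSq, pdz u p ^ 2 := by
  have huc := hu.continuous
  have hc := continuous_intervalIntegral_fst (hu.pdx.continuous.fun_pow 2)
  rw [← integral_two_mul_add_const hu]
  exact intervalIntegral.integral_mono_on zero_le_one
    (Continuous.intervalIntegrable (by fun_prop) _ _)
    (Continuous.intervalIntegrable (by fun_prop) _ _)
    fun z hz => sq_le_of_integral_eq_zero hu hmean hx hz

/-- Poincaré inequality for functions of zero mean on the unit square. -/
lemma integral_sq_le_of_integral_eq_zero (hu : ContDiff ℝ ∞ u)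
    (hmean : ∫ p in unitSq, u p = 0) :
    ∫ p in unitSq, u p ^ 2 ≤
      2 * (∫ p in unitSq, pdx u p ^ 2) + 2 * ∫ p in unitSq, pdz u p ^ 2 := by
  have huc := hu.continuous
  rw [setIntegral_unitSq' (huc.fun_pow 2)]
  calc ∫ x in (0 : ℝ)..1, ∫ z in (0 : ℝ)..1, u (x, z) ^ 2
      ≤ ∫ _ in (0 : ℝ)..1,
          (2 * (∫ p in unitSq, pdx u p ^ 2) + 2 * ∫ p in unitSq, pdz u p ^ 2) :=
        intervalIntegral.integral_mono_on zero_le_one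
          ((continuous_intervalIntegral_snd (huc.fun_pow 2)).intervalIntegrable _ _)
          (continuous_const.intervalIntegrable _ _)
          fun x hx => integral_trace_sq_le hu hmean hx
    _ = _ := by simp

/-- Poincaré inequality for functions vanishing on the boundary of the unit square. -/
lemma integral_sq_le_of_eq_zero_on_frontier (hu : ContDiff ℝ ∞ u)
    (hu0 : ∀ p ∈ frontier unitSq, u p = 0) :
    ∫ p in unitSq, u p ^ 2 ≤ ∫ p in unitSq, pdx u p ^ 2 := by
  have hsq := hu.pdx.continuous.fun_pow 2
  have husq := hu.continuous.fun_pow 2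
  rw [setIntegral_unitSq husq, setIntegral_unitSq hsq]
  refine intervalIntegral.integral_mono_on zero_le_one
    ((continuous_intervalIntegral_fst husq).intervalIntegrable _ _)
    ((continuous_intervalIntegral_fst hsq).intervalIntegrable _ _) fun z hz => ?_
  have hslice : ∀ x ∈ Set.Icc (0 : ℝ) 1,
      u (x, z) ^ 2 ≤ ∫ s in (0 : ℝ)..1, pdx u (s, z) ^ 2 := by
    intro x hx
    have h := sq_sub_le_integral_sq_deriv (fun s => hasDerivAt_pdx hu s z)
      (hu.pdx.continuous.comp (by fun_prop : Continuous fun s : ℝ => (s, z)))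
      (Set.left_mem_Icc.2 zero_le_one) hx
    rwa [hu0 (0, z) (mk_mem_frontier_unitSq (by simp) hz (by simp)), sub_zero] at h
  calc ∫ x in (0 : ℝ)..1, u (x, z) ^ 2
      ≤ ∫ _ in (0 : ℝ)..1, ∫ s in (0 : ℝ)..1, pdx u (s, z) ^ 2 :=
        intervalIntegral.integral_mono_on zero_le_one
          ((husq.comp (by fun_prop : Continuous fun x : ℝ => (x, z))).intervalIntegrable _ _)
          (continuous_const.intervalIntegrable _ _) hslice
    _ = _ := by simp

end Poincare

section TimeEvolution

variable {f : ℝ → ℝ × ℝ → ℝ}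

lemma JointlySmooth.contDiff_slice (hf : JointlySmooth f) (t : ℝ) : ContDiff ℝ ∞ (f t) :=
  ContDiff.comp (g := fun q : ℝ × (ℝ × ℝ) => f q.1 q.2) hf (contDiff_prodMk_right t)

lemma JointlySmooth.sq (hf : JointlySmooth f) : JointlySmooth fun t p => f t p ^ 2 :=
  ContDiff.pow hf 2

lemma JointlySmooth.hasDerivAt (hf : JointlySmooth f) (t : ℝ) (p : ℝ × ℝ) :
    HasDerivAt (fun s => f s p)
      (fderiv ℝ (fun q : ℝ × (ℝ × ℝ) => f q.1 q.2) (t, p) (1, 0)) t := by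
  have h := ((ContDiff.differentiable hf (by simp)) (t, p)).hasFDerivAt
  exact h.comp_hasDerivAt t ((hasDerivAt_id t).prodMk (hasDerivAt_const t p))

/-- Differentiation under the integral sign over the unit square. -/
lemma JointlySmooth.hasDerivAt_integral (hf : JointlySmooth f) (t : ℝ) :
    HasDerivAt (fun s => ∫ p in unitSq, f s p)
      (∫ p in unitSq, deriv (fun s => f s p) t) t := by
  have hcont : Continuous fun w : ℝ × (ℝ × ℝ) =>
      fderiv ℝ (fun q : ℝ × (ℝ × ℝ) => f q.1 q.2) w (1, 0) :=
    (ContDiff.continuous_fderiv hf (by simp)).clm_apply continuous_const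
  obtain ⟨C, hC⟩ := (isCompact_Icc (a := t - 1) (b := t + 1)).prod isCompact_unitSq
    |>.exists_bound_of_continuousOn hcont.continuousOn
  have hderiv : ∀ s p, deriv (fun s => f s p) s =
      fderiv ℝ (fun q : ℝ × (ℝ × ℝ) => f q.1 q.2) (s, p) (1, 0) :=
    fun s p => (hf.hasDerivAt s p).deriv
  simp only [hderiv]
  refine (hasDerivAt_integral_of_dominated_loc_of_deriv_le
    (F' := fun s p => fderiv ℝ (fun q : ℝ × (ℝ × ℝ) => f q.1 q.2) (s, p) (1, 0))
    (bound := fun _ => C)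
    (Icc_mem_nhds (by linarith : t - 1 < t) (by linarith : t < t + 1)) ?_ ?_ ?_ ?_ ?_ ?_).2
  · exact Filter.Eventually.of_forall fun s =>
      (hf.contDiff_slice s).continuous.aestronglyMeasurable
  · exact (hf.contDiff_slice t).continuous.integrableOn_unitSq
  · exact (hcont.comp (by fun_prop : Continuous fun p : ℝ × ℝ => (t, p))).aestronglyMeasurable
  · filter_upwards [ae_restrict_mem measurableSet_unitSq] with p hp s hs
    exact hC (s, p) ⟨hs, hp⟩
  · exact continuous_const.integrableOn_unitSq
  · exact ae_of_all _ fun p s _ => hf.hasDerivAt s p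

lemma JointlySmooth.deriv_sq (hf : JointlySmooth f) (t : ℝ) (p : ℝ × ℝ) :
    deriv (fun s => f s p ^ 2) t = 2 * (f t p * deriv (fun s => f s p) t) := by
  have h := hf.hasDerivAt t p
  rw [(h.fun_pow 2).deriv, h.deriv]
  push_cast
  ring

end TimeEvolution

/-- Exponential relaxation for the differential inequality `y' ≤ -α y + β`. -/
lemma le_of_hasDerivAt_le_neg_mul_add {y y' : ℝ → ℝ} {α β : ℝ} (hα : 0 < α)
    (hy : ∀ t, HasDerivAt y (y' t) t) (hle : ∀ t ≥ 0, y' t ≤ -α * y t + β) {t : ℝ} (ht : 0 ≤ t) :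
    y t ≤ β / α + (y 0 - β / α) * Real.exp (-α * t) := by
  have hd : ∀ s, HasDerivAt (fun s => (y s - β / α) * Real.exp (α * s))
      (y' s * Real.exp (α * s) + (y s - β / α) * (Real.exp (α * s) * (α * 1))) s := fun s =>
    ((hy s).sub_const _).mul ((hasDerivAt_id s).const_mul α).exp
  have hanti : AntitoneOn (fun s => (y s - β / α) * Real.exp (α * s)) (Set.Ici 0) := by
    refine antitoneOn_of_deriv_nonpos (convex_Ici 0)
      (fun s _ => (hd s).continuousAt.continuousWithinAt)
      (fun s _ => (hd s).differentiableAt.differentiableWithinAt) fun s hs => ?_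
    rw [interior_Ici] at hs
    rw [(hd s).deriv]
    have hfac : y' s * Real.exp (α * s) + (y s - β / α) * (Real.exp (α * s) * (α * 1)) =
        (y' s - (-α * y s + β)) * Real.exp (α * s) := by
      field_simp
      ring
    rw [hfac]
    exact mul_nonpos_of_nonpos_of_nonneg (by linarith [hle s (le_of_lt hs)]) (Real.exp_pos _).le
  have h := hanti Set.self_mem_Ici ht ht
  simp only [mul_zero, Real.exp_zero, mul_one] at h
  have hexp : Real.exp (α * t) * Real.exp (-α * t) = 1 := by
    rw [← Real.exp_add]
    simp
  have h2 := mul_le_mul_of_nonneg_right h (Real.exp_pos (-α * t)).le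
  rw [mul_assoc, hexp, mul_one] at h2
  linarith

lemma limsup_le_of_hasDerivAt_le_neg_mul_add {e y y' : ℝ → ℝ} {α β : ℝ} (hα : 0 < α)
    (hy : ∀ t, HasDerivAt y (y' t) t) (hle : ∀ t ≥ 0, y' t ≤ -α * y t + β)
    (he : ∀ t, 0 ≤ e t) (hey : ∀ t, e t ≤ y t) :
    Filter.limsup e Filter.atTop ≤ β / α := by
  have hexp : Filter.Tendsto (fun t : ℝ => Real.exp (-α * t)) Filter.atTop (nhds 0) := by
    refine Real.tendsto_exp_atBot.comp ?_
    exact Filter.tendsto_id.const_mul_atTop_of_neg (neg_neg_of_pos hα)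
  have hlim : Filter.Tendsto (fun t => β / α + (y 0 - β / α) * Real.exp (-α * t))
      Filter.atTop (nhds (β / α)) := by
    simpa using (hexp.const_mul (y 0 - β / α)).const_add (β / α)
  rw [← hlim.limsup_eq]
  refine Filter.limsup_le_limsup ?_ ?_ hlim.isBoundedUnder_le
  · filter_upwards [Filter.eventually_ge_atTop 0] with t ht
    exact (hey t).trans (le_of_hasDerivAt_le_neg_mul_add hα hy hle ht)
  · exact (Filter.isBoundedUnder_of ⟨0, he⟩ :
      Filter.atTop.IsBoundedUnder (· ≥ ·) e).isCoboundedUnder_le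

section EnergyBalance

variable {Ra κ : ℝ} {u v ψ w : ℝ × ℝ → ℝ}

/-- Vorticity part of the energy balance: `w` is the time derivative of `u`. -/
lemma integral_mul_vorticity_le (hu : ContDiff ℝ ∞ u) (hv : ContDiff ℝ ∞ v) (hψ : ContDiff ℝ ∞ ψ)
    (hψ0 : ∀ p ∈ frontier unitSq, ψ p = 0) (hu0 : ∀ p ∈ frontier unitSq, u p = 0)
    (heq : ∀ p ∈ unitSq, w p + Jac u ψ p = lap u p - Ra * pdx v p) :
    ∫ p in unitSq, 2 * (u p * w p) ≤
      -(∫ p in unitSq, u p ^ 2) + Ra ^ 2 * ∫ p in unitSq, pdx v p ^ 2 := by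
  have huc := hu.continuous
  have hlapc := hu.lap.continuous
  have hJc := (hu.jac hψ).continuous
  have hvc := hv.pdx.continuous
  have h0 : (0 : ℝ) ∈ Set.Icc (0 : ℝ) 1 := by simp
  have h1 : (1 : ℝ) ∈ Set.Icc (0 : ℝ) 1 := by simp
  have hgreen : ∫ p in unitSq, u p * lap u p =
      -((∫ p in unitSq, pdx u p ^ 2) + ∫ p in unitSq, pdz u p ^ 2) := by
    rw [integral_mul_lap hu, intervalIntegral_eq_zero_of_forall fun s hs => ?_,
      intervalIntegral_eq_zero_of_forall fun s hs => ?_,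
      intervalIntegral_eq_zero_of_forall fun s hs => ?_,
      intervalIntegral_eq_zero_of_forall fun s hs => ?_]
    · ring
    · simp [hu0 _ (mk_mem_frontier_unitSq h0 hs (by simp))]
    · simp [hu0 _ (mk_mem_frontier_unitSq h1 hs (by simp))]
    · simp [hu0 _ (mk_mem_frontier_unitSq hs h0 (by simp))]
    · simp [hu0 _ (mk_mem_frontier_unitSq hs h1 (by simp))]
  have hpoint : ∀ p ∈ unitSq, 2 * (u p * w p) ≤
      2 * (u p * lap u p) - 2 * (u p * Jac u ψ p) + (u p ^ 2 + Ra ^ 2 * pdx v p ^ 2) := by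
    intro p hp
    have hw : w p = lap u p - Ra * pdx v p - Jac u ψ p := by linarith [heq p hp]
    rw [hw]
    nlinarith [sq_nonneg (u p + Ra * pdx v p)]
  have hwint : IntegrableOn (fun p => 2 * (u p * w p)) unitSq := by
    refine (Continuous.integrableOn_unitSq (f := fun p =>
      2 * (u p * (lap u p - Ra * pdx v p - Jac u ψ p))) (by fun_prop)).congr_fun
      (fun p hp => ?_) measurableSet_unitSq
    simp only [show w p = lap u p - Ra * pdx v p - Jac u ψ p by linarith [heq p hp]]
  have hmono := setIntegral_mono_on hwint
    (Continuous.integrableOn_unitSq (by fun_prop)) measurableSet_unitSq hpoint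
  have i1 : IntegrableOn (fun p => 2 * (u p * lap u p)) unitSq :=
    Continuous.integrableOn_unitSq (by fun_prop)
  have i2 : IntegrableOn (fun p => 2 * (u p * Jac u ψ p)) unitSq :=
    Continuous.integrableOn_unitSq (by fun_prop)
  have i3 : IntegrableOn (fun p => u p ^ 2) unitSq :=
    Continuous.integrableOn_unitSq (by fun_prop)
  have i4 : IntegrableOn (fun p => Ra ^ 2 * pdx v p ^ 2) unitSq :=
    Continuous.integrableOn_unitSq (by fun_prop)
  simp only [integral_add (i1.fun_sub i2) (i3.fun_add i4), integral_sub i1 i2,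
    integral_add i3 i4, integral_const_mul, hgreen, integral_mul_Jac_eq_zero hu hψ hψ0] at hmono
  rw [integral_const_mul]
  have hpoin := integral_sq_le_of_eq_zero_on_frontier hu hu0
  have hz : 0 ≤ ∫ p in unitSq, pdz u p ^ 2 := integral_nonneg fun p => sq_nonneg _
  linarith

/-- The mean salinity is conserved when the inlet flux has zero mean. -/
lemma integral_salinity_rate_eq_zero (hv : ContDiff ℝ ∞ v) (hψ : ContDiff ℝ ∞ ψ)
    (hψ0 : ∀ p ∈ frontier unitSq, ψ p = 0)
    (hF : ∫ z in (0 : ℝ)..1, pdx v (0, z) = 0)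
    (hx1 : ∀ z ∈ Set.Icc (0 : ℝ) 1, pdx v (1, z) = 0)
    (hz0 : ∀ x ∈ Set.Icc (0 : ℝ) 1, pdz v (x, 0) = 0)
    (hz1 : ∀ x ∈ Set.Icc (0 : ℝ) 1, pdz v (x, 1) = 0)
    (heq : ∀ p ∈ unitSq, w p + Jac v ψ p = κ * lap v p) :
    ∫ p in unitSq, w p = 0 := by
  have hlap : ∫ p in unitSq, lap v p = 0 := by
    simp only [lap]
    rw [integral_div_unitSq hv.pdx hv.pdz, hF, intervalIntegral_eq_zero_of_forall hz0,
      intervalIntegral_eq_zero_of_forall hz1, intervalIntegral_eq_zero_of_forall hx1]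
    simp
  rw [setIntegral_congr_fun (g := fun p => κ * lap v p - Jac v ψ p) measurableSet_unitSq
    fun p hp => by linarith [heq p hp],
    integral_sub (hv.lap.continuous.const_mul κ).integrableOn_unitSq
      (hv.jac hψ).continuous.integrableOn_unitSq, integral_const_mul, hlap,
    integral_Jac_eq_zero hv hψ hψ0]
  simp

/-- Salinity part of the energy balance: `w` is the time derivative of `v`. -/
lemma integral_mul_salinity_le (hκ : 0 ≤ κ) (hv : ContDiff ℝ ∞ v) (hψ : ContDiff ℝ ∞ ψ)
    (hψ0 : ∀ p ∈ frontier unitSq, ψ p = 0) (hmean : ∫ p in unitSq, v p = 0)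
    (hx1 : ∀ z ∈ Set.Icc (0 : ℝ) 1, pdx v (1, z) = 0)
    (hz0 : ∀ x ∈ Set.Icc (0 : ℝ) 1, pdz v (x, 0) = 0)
    (hz1 : ∀ x ∈ Set.Icc (0 : ℝ) 1, pdz v (x, 1) = 0)
    (heq : ∀ p ∈ unitSq, w p + Jac v ψ p = κ * lap v p) :
    ∫ p in unitSq, 2 * (v p * w p) ≤
      κ * (2 * (∫ z in (0 : ℝ)..1, pdx v (0, z) ^ 2) -
        ((∫ p in unitSq, pdx v p ^ 2) + ∫ p in unitSq, pdz v p ^ 2)) := by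
  have hvc := hv.continuous
  have hlapc := hv.lap.continuous
  have hJc := (hv.jac hψ).continuous
  have hxc := hv.pdx.continuous
  have i1 : IntegrableOn (fun p => 2 * κ * (v p * lap v p)) unitSq :=
    Continuous.integrableOn_unitSq (by fun_prop)
  have i2 : IntegrableOn (fun p => 2 * (v p * Jac v ψ p)) unitSq :=
    Continuous.integrableOn_unitSq (by fun_prop)
  have hbalance : ∫ p in unitSq, 2 * (v p * w p) = 2 * κ * ∫ p in unitSq, v p * lap v p := by
    rw [setIntegral_congr_fun (g := fun p => 2 * κ * (v p * lap v p) - 2 * (v p * Jac v ψ p))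
      measurableSet_unitSq fun p hp => ?_, integral_sub i1 i2, integral_const_mul,
      integral_const_mul, integral_mul_Jac_eq_zero hv hψ hψ0]
    · simp
    · have hw : w p = κ * lap v p - Jac v ψ p := by linarith [heq p hp]
      simp only [hw]
      ring
  have hgreen : ∫ p in unitSq, v p * lap v p = -(∫ z in (0 : ℝ)..1, v (0, z) * pdx v (0, z)) -
      ((∫ p in unitSq, pdx v p ^ 2) + ∫ p in unitSq, pdz v p ^ 2) := by
    rw [integral_mul_lap hv,
      intervalIntegral_eq_zero_of_forall (h := fun x => v (x, 1) * pdz v (x, 1))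
        fun s hs => by simp [hz1 s hs],
      intervalIntegral_eq_zero_of_forall (h := fun x => v (x, 0) * pdz v (x, 0))
        fun s hs => by simp [hz0 s hs],
      intervalIntegral_eq_zero_of_forall (h := fun z => v (1, z) * pdx v (1, z))
        fun s hs => by simp [hx1 s hs]]
    ring
  have hyoung : -(4 * ∫ z in (0 : ℝ)..1, v (0, z) * pdx v (0, z)) ≤
      (∫ z in (0 : ℝ)..1, v (0, z) ^ 2) + 4 * ∫ z in (0 : ℝ)..1, pdx v (0, z) ^ 2 := by
    rw [← intervalIntegral.integral_const_mul, ← intervalIntegral.integral_const_mul,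
      ← intervalIntegral.integral_neg, ← intervalIntegral.integral_add
        (Continuous.intervalIntegrable (by fun_prop) _ _)
        (Continuous.intervalIntegrable (by fun_prop) _ _)]
    refine intervalIntegral.integral_mono_on zero_le_one
      (Continuous.intervalIntegrable (by fun_prop) _ _)
      (Continuous.intervalIntegrable (by fun_prop) _ _) fun z _ => ?_
    nlinarith [sq_nonneg (v (0, z) + 2 * pdx v (0, z))]
  have htrace := integral_trace_sq_le hv hmean (Set.left_mem_Icc.2 zero_le_one)
  rw [hbalance, hgreen, mul_comm 2 κ, mul_assoc]
  refine mul_le_mul_of_nonneg_left ?_ hκ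
  linarith

end EnergyBalance

/-- Asymptotic enstrophy and mean-square salinity estimate for the coupled
gravity-currents system: there is a constant `C ≥ 0` depending only on `Ra`
and `Pr` such that the energy is asymptotically bounded by `C ∫₀¹ F²`. -/
theorem asymptotic_enstrophy_salinity (Ra Pr : ℝ) (hPr : 0 < Pr) :
    ∃ C : ℝ, 0 ≤ C ∧
      ∀ (F : ℝ → ℝ) (q S ψ : ℝ → ℝ × ℝ → ℝ),
        ContinuousOn F (Set.Icc 0 1) →
        (∫ z in Set.Icc (0:ℝ) 1, F z) = 0 →
        JointlySmooth q → JointlySmooth S → JointlySmooth ψ →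
        (∀ t ≥ (0:ℝ), ∀ p ∈ unitSq, q t p = -(lap (ψ t) p)) →
        (∀ t ≥ (0:ℝ), ∀ p ∈ frontier unitSq, ψ t p = 0) →
        (∀ t ≥ (0:ℝ), ∀ p ∈ frontier unitSq, q t p = 0) →
        (∀ t ≥ (0:ℝ), ∀ z ∈ Set.Icc (0:ℝ) 1, pdx (S t) (0, z) = F z) →
        (∀ t ≥ (0:ℝ), ∀ z ∈ Set.Icc (0:ℝ) 1, pdx (S t) (1, z) = 0) →
        (∀ t ≥ (0:ℝ), ∀ x ∈ Set.Icc (0:ℝ) 1, pdz (S t) (x, 0) = 0) →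
        (∀ t ≥ (0:ℝ), ∀ x ∈ Set.Icc (0:ℝ) 1, pdz (S t) (x, 1) = 0) →
        (∀ t ≥ (0:ℝ), ∀ p ∈ unitSq,
          deriv (fun s => q s p) t + Jac (q t) (ψ t) p
            = lap (q t) p - Ra * pdx (S t) p) →
        (∀ t ≥ (0:ℝ), ∀ p ∈ unitSq,
          deriv (fun s => S s p) t + Jac (S t) (ψ t) p = (1 / Pr) * lap (S t) p) →
        (∫ p in unitSq, S 0 p) = 0 →
        Filter.limsup (fun t : ℝ => ∫ p in unitSq, ((q t p) ^ 2 + (S t p) ^ 2))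
            Filter.atTop
          ≤ C * ∫ z in Set.Icc (0:ℝ) 1, (F z) ^ 2 := by
  set K : ℝ := Pr * (Ra ^ 2 + 1) + 1 with hK
  have hK1 : 1 ≤ K := by
    have : 0 ≤ Pr * (Ra ^ 2 + 1) := by positivity
    linarith
  have hK0 : 0 < K := by linarith
  refine ⟨2 * (K / Pr) / (1 / (2 * K)), by positivity, ?_⟩
  intro F q S ψ _ hF0 hq hS hψ _ hψ0 hq0 hx0 hx1 hz0 hz1 hqeq hSeq hmean0
  have hflux : ∀ t ≥ (0 : ℝ), ∀ φ : ℝ → ℝ,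
      ∫ z in (0 : ℝ)..1, φ (pdx (S t) (0, z)) = ∫ z in Set.Icc (0 : ℝ) 1, φ (F z) := by
    intro t ht φ
    rw [intervalIntegral.integral_of_le zero_le_one, ← integral_Icc_eq_integral_Ioc]
    exact setIntegral_congr_fun measurableSet_Icc fun z hz => by simp only [hx0 t ht z hz]
  have hmean : ∀ t ≥ (0 : ℝ), ∫ p in unitSq, S t p = 0 := by
    intro t ht
    rw [← hmean0]
    refine constant_of_has_deriv_right_zero (a := 0) (b := t)
      (fun s _ => (hS.hasDerivAt_integral s).continuousAt.continuousWithinAt)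
      (fun s hs => ?_) t ⟨ht, le_rfl⟩
    have h := hS.hasDerivAt_integral s
    rw [integral_salinity_rate_eq_zero (hS.contDiff_slice s) (hψ.contDiff_slice s) (hψ0 s hs.1)
      ((hflux s hs.1 id).trans hF0) (hx1 s hs.1) (hz0 s hs.1) (hz1 s hs.1) (hSeq s hs.1)] at h
    exact h.hasDerivWithinAt
  set Φ : ℝ := ∫ z in Set.Icc (0 : ℝ) 1, F z ^ 2
  have hderiv := fun t => (hq.sq.hasDerivAt_integral t).add
    ((hS.sq.hasDerivAt_integral t).const_mul K)
  simp only [hq.deriv_sq, hS.deriv_sq] at hderiv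
  rw [div_mul_eq_mul_div]
  refine limsup_le_of_hasDerivAt_le_neg_mul_add (by positivity) hderiv (fun t ht => ?_)
    (fun t => integral_nonneg fun p => by positivity) fun t => ?_
  · have hvort := integral_mul_vorticity_le (hq.contDiff_slice t) (hS.contDiff_slice t)
      (hψ.contDiff_slice t) (hψ0 t ht) (hq0 t ht) (hqeq t ht)
    have hsal := integral_mul_salinity_le (by positivity) (hS.contDiff_slice t)
      (hψ.contDiff_slice t) (hψ0 t ht) (hmean t ht) (hx1 t ht) (hz0 t ht) (hz1 t ht) (hSeq t ht)
    rw [hflux t ht fun r => r ^ 2] at hsal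
    have hpoin := integral_sq_le_of_integral_eq_zero (hS.contDiff_slice t) (hmean t ht)
    have hGz : 0 ≤ ∫ p in unitSq, pdz (S t) p ^ 2 := integral_nonneg fun p => sq_nonneg _
    have hGx : 0 ≤ ∫ p in unitSq, pdx (S t) p ^ 2 := integral_nonneg fun p => sq_nonneg _
    have hQ : 0 ≤ ∫ p in unitSq, q t p ^ 2 := integral_nonneg fun p => sq_nonneg _
    have hKPr : K / Pr = Ra ^ 2 + 1 + 1 / Pr := by
      rw [hK]
      field_simp
    have hsalK := mul_le_mul_of_nonneg_left hsal hK0.le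
    simp only [Pi.add_apply]
    generalize (∫ p in unitSq, pdz (S t) p ^ 2) = Gz at *
    generalize (∫ p in unitSq, pdx (S t) p ^ 2) = Gx at *
    generalize (∫ p in unitSq, q t p ^ 2) = Q at *
    generalize (∫ p in unitSq, S t p ^ 2) = E at *
    have hrhs : K * (1 / Pr * (2 * Φ - (Gx + Gz))) =
        2 * (K / Pr) * Φ - (Ra ^ 2 + 1) * (Gx + Gz) - 1 / Pr * (Gx + Gz) := by
      linear_combination -(Gx + Gz) * hKPr
    have hdamp : -(1 / (2 * K)) * (Q + K * E) = -(1 / (2 * K) * Q) - E / 2 := by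
      field_simp
      ring
    have hsmall : 1 / (2 * K) * Q ≤ Q := by
      refine mul_le_of_le_one_left hQ ?_
      rw [div_le_one (by positivity)]
      linarith
    have hPrG : 0 ≤ 1 / Pr * (Gx + Gz) := by positivity
    have hRaG : 0 ≤ Ra ^ 2 * Gz := by positivity
    linarith
  · have hqi := (hq.sq.contDiff_slice t).continuous.integrableOn_unitSq
    have hSi := (hS.sq.contDiff_slice t).continuous.integrableOn_unitSq
    rw [integral_add hqi hSi]
    have hE : 0 ≤ ∫ p in unitSq, S t p ^ 2 := integral_nonneg fun p => sq_nonneg _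
    simp only [Pi.add_apply]
    nlinarith
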